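/- arXiv:2501.07310 — 2 statements merged into one kernel-verified Lean document; each statement's English description precedes it below -/
import Mathlib

section
/- Suppose A is τ-tilting finite, i.e. mod A has only finitely many torsion classes. Then the bricks in mod A are uniquely determined by their Newton polytopes: if U and V are bricks with N(U) = N(V), then U and V are isomorphic. -/
/-! Common definitions: finite-dimensional modules over a finite-dimensional algebra,
quotient modules, dimension vectors via composition series, Newton polytopes,
torsion classes, `Fac`, τ-rigidity, bricks, etc. -/

variable (A : Type) [Ring A]

/-- `X` is a quotient module of `M`. -/
def IsQuotientOf (M X : ModuleCat.{0} A) : Prop :=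
  ∃ f : M →ₗ[A] X, Function.Surjective f

open Classical in
/-- The dimension vector of a module `M`, relative to a family `S : Fin n → ModuleCat A`
of (representatives of the isomorphism classes of the) simple `A`-modules: its `i`-th entry
is the multiplicity of `S i` as a composition factor of `M` (well defined by Jordan–Hölder,
for `M` of finite length). -/
noncomputable def dimVec {n : ℕ} (S : Fin n → ModuleCat.{0} A)
    (M : Type) [AddCommGroup M] [Module A M] : Fin n → ℕ := fun i =>
  if h : ∃ s : CompositionSeries (Submodule A M),
      RelSeries.head s = ⊥ ∧ RelSeries.last s = ⊤ then
    Nat.card {j : Fin h.choose.length //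
      Nonempty ((↥(h.choose j.succ) ⧸
        (Submodule.comap (h.choose j.succ).subtype
          (h.choose j.castSucc))) ≃ₗ[A] S i)}
  else 0

/-- The Newton polytope of `U`: the convex hull in `ℝⁿ` of the dimension vectors of
the quotient modules of `U`. -/
noncomputable def newtonPolytope {n : ℕ} (S : Fin n → ModuleCat.{0} A)
    (U : ModuleCat.{0} A) : Set (Fin n → ℝ) :=
  convexHull ℝ { v : Fin n → ℝ | ∃ p : Submodule A U,
    v = fun i => ((dimVec A S (↥U ⧸ p) i : ℕ) : ℝ) }

/-- `Fac M`: the class of quotient modules of finite direct sums of copies of `M`. -/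
def Fac (M : ModuleCat.{0} A) : Set (ModuleCat.{0} A) :=
  { X | ∃ (k : ℕ) (f : (Fin k → M) →ₗ[A] X), Function.Surjective f }

/-- A torsion class in `mod A`: a class of finite-dimensional `A`-modules closed under
isomorphisms, quotient modules and extensions. -/
def IsTorsionClass (T : Set (ModuleCat.{0} A)) : Prop :=
  (∀ M ∈ T, Module.Finite A M) ∧
  (∀ M ∈ T, ∀ N : ModuleCat.{0} A, Nonempty (M ≃ₗ[A] N) → N ∈ T) ∧
  (∀ M ∈ T, ∀ X : ModuleCat.{0} A, IsQuotientOf A M X → X ∈ T) ∧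
  (∀ (L E N : ModuleCat.{0} A) (f : L →ₗ[A] E) (g : E →ₗ[A] N),
    Function.Injective f → Function.Surjective g →
    LinearMap.range f = LinearMap.ker g → L ∈ T → N ∈ T → E ∈ T)

/-- `⟨N⟩_tors`, the smallest torsion class containing `N`. -/
def torsGen (N : ModuleCat.{0} A) : Set (ModuleCat.{0} A) :=
  ⋂₀ { T | IsTorsionClass A T ∧ N ∈ T }

/-- A module `N` is left finite if the torsion class it generates is functorially finite,
i.e. `⟨N⟩_tors = Fac M` for some `M` in `mod A`. -/
def LeftFinite (N : ModuleCat.{0} A) : Prop :=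
  ∃ M : ModuleCat.{0} A, Module.Finite A M ∧ torsGen A N = Fac A M

/-- `M` is τ-rigid: `Ext¹(M, X) = 0` for every `X ∈ Fac M`, expressed by the splitting of
every short exact sequence `0 → X → E → M → 0`. -/
def IsTauRigid (M : ModuleCat.{0} A) : Prop :=
  ∀ X ∈ Fac A M, ∀ (E : ModuleCat.{0} A) (f : X →ₗ[A] E) (g : E →ₗ[A] M),
    Function.Injective f → Function.Surjective g → LinearMap.range f = LinearMap.ker g →
    ∃ s : M →ₗ[A] E, g.comp s = LinearMap.id

/-- `M` is indecomposable. -/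
def Indecomposable (M : ModuleCat.{0} A) : Prop :=
  Nontrivial M ∧ ∀ (M₁ M₂ : ModuleCat.{0} A),
    Nonempty (M ≃ₗ[A] (M₁ × M₂)) → (Subsingleton M₁ ∨ Subsingleton M₂)

/-- `M` is a brick: its endomorphism ring is a division ring, i.e. `M ≠ 0` and every
nonzero endomorphism of `M` is invertible. -/
def IsBrick (M : ModuleCat.{0} A) : Prop :=
  Nontrivial M ∧ ∀ f : M →ₗ[A] M, f ≠ 0 → Function.Bijective f

section TorsionClasses

variable {A}

lemma exists_comp_eq_of_ker_le {X Y Z : Type} [AddCommGroup X] [Module A X] [AddCommGroup Y]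
    [Module A Y] [AddCommGroup Z] [Module A Z] {g : X →ₗ[A] Y} (hg : Function.Surjective g)
    (u : X →ₗ[A] Z) (h : LinearMap.ker g ≤ LinearMap.ker u) :
    ∃ v : Y →ₗ[A] Z, v.comp g = u := by
  refine ⟨((LinearMap.ker g).liftQ u h).comp
    (g.quotKerEquivOfSurjective hg).symm.toLinearMap, ?_⟩
  ext x
  have : (g.quotKerEquivOfSurjective hg).symm (g x) = (LinearMap.ker g).mkQ x := by
    rw [LinearEquiv.symm_apply_eq]; rfl
  rw [LinearMap.comp_apply, LinearMap.comp_apply, LinearEquiv.coe_coe, this]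
  exact Submodule.liftQ_apply _ _ _

namespace IsTorsionClass

variable {T : Set (ModuleCat.{0} A)} {X Y Z : Type} [AddCommGroup X] [Module A X]
  [AddCommGroup Y] [Module A Y] [AddCommGroup Z] [Module A Z]

lemma mem_of_surjective (hT : IsTorsionClass A T) (hX : ModuleCat.of A X ∈ T)
    (f : X →ₗ[A] Y) (hf : Function.Surjective f) : ModuleCat.of A Y ∈ T :=
  hT.2.2.1 _ hX (ModuleCat.of A Y) ⟨f, hf⟩

lemma mem_of_exact (hT : IsTorsionClass A T) (f : X →ₗ[A] Y) (g : Y →ₗ[A] Z)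
    (hf : Function.Injective f) (hg : Function.Surjective g)
    (hfg : LinearMap.range f = LinearMap.ker g)
    (hX : ModuleCat.of A X ∈ T) (hZ : ModuleCat.of A Z ∈ T) : ModuleCat.of A Y ∈ T :=
  hT.2.2.2 (ModuleCat.of A X) (ModuleCat.of A Y) (ModuleCat.of A Z) f g hf hg hfg hX hZ

lemma range_mem (hT : IsTorsionClass A T) (hX : ModuleCat.of A X ∈ T) (f : X →ₗ[A] Y) :
    ModuleCat.of A (LinearMap.range f) ∈ T :=
  hT.mem_of_surjective hX f.rangeRestrict f.surjective_rangeRestrict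

lemma prod_mem (hT : IsTorsionClass A T) (hX : ModuleCat.of A X ∈ T)
    (hY : ModuleCat.of A Y ∈ T) : ModuleCat.of A (X × Y) ∈ T :=
  hT.mem_of_exact (LinearMap.inl A X Y) (LinearMap.snd A X Y) LinearMap.inl_injective
    LinearMap.snd_surjective (LinearMap.range_inl A X Y) hX hY

lemma subsingleton_mem (hT : IsTorsionClass A T) (hX : ModuleCat.of A X ∈ T)
    [Subsingleton Y] : ModuleCat.of A Y ∈ T :=
  hT.mem_of_surjective hX (0 : X →ₗ[A] Y) fun _ => ⟨0, Subsingleton.elim _ _⟩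

lemma pi_mem (hT : IsTorsionClass A T) (hX : ModuleCat.of A X ∈ T) (k : ℕ) :
    ModuleCat.of A (Fin k → X) ∈ T := by
  induction k with
  | zero => exact hT.subsingleton_mem hX
  | succ k ih =>
    exact hT.mem_of_surjective (hT.prod_mem hX ih) (Fin.consLinearEquiv A fun _ => X).toLinearMap
      (Fin.consLinearEquiv A fun _ => X).surjective

lemma fac_subset (hT : IsTorsionClass A T) {M : ModuleCat.{0} A} (hM : M ∈ T) :
    Fac A M ⊆ T := by
  rintro Y ⟨k, f, hf⟩
  exact hT.mem_of_surjective (hT.pi_mem hM k) f hf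

lemma inter {T' : Set (ModuleCat.{0} A)} (hT : IsTorsionClass A T)
    (hT' : IsTorsionClass A T') : IsTorsionClass A (T ∩ T') :=
  ⟨fun M h => hT.1 M h.1, fun M h N e => ⟨hT.2.1 M h.1 N e, hT'.2.1 M h.2 N e⟩,
    fun M h N e => ⟨hT.2.2.1 M h.1 N e, hT'.2.2.1 M h.2 N e⟩,
    fun L E N f g hf hg hfg hL hN => ⟨hT.2.2.2 L E N f g hf hg hfg hL.1 hN.1,
      hT'.2.2.2 L E N f g hf hg hfg hL.2 hN.2⟩⟩

end IsTorsionClass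

variable (A) in
/-- The class of all finitely generated modules. -/
def finiteModules : Set (ModuleCat.{0} A) := {M | Module.Finite A M}

variable (A) in
lemma isTorsionClass_finiteModules : IsTorsionClass A (finiteModules A) := by
  refine ⟨fun M h => h, fun M h N ⟨e⟩ => ?_, fun M h N ⟨f, hf⟩ => ?_,
    fun L E N f g hf hg hfg hL hN => ?_⟩
  · have : Module.Finite A M := h
    exact Module.Finite.equiv e
  · have : Module.Finite A M := h
    exact Module.Finite.of_surjective f hf
  · have : Module.Finite A L := hL
    have : Module.Finite A N := hN
    have : Module.Finite A (LinearMap.ker g) := by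
      rw [← hfg]; infer_instance
    have : Module.Finite A (LinearMap.range g) := by
      rw [LinearMap.range_eq_top.2 hg]; infer_instance
    have : Module.Finite A (E ⧸ LinearMap.ker g) := Module.Finite.equiv g.quotKerEquivRange.symm
    exact Module.Finite.of_submodule_quotient (LinearMap.ker g)

/-- The finitely generated modules without nonzero homomorphisms to `X`. -/
def leftPerp (X : Type) [AddCommGroup X] [Module A X] : Set (ModuleCat.{0} A) :=
  {M | Module.Finite A M ∧ ∀ f : M →ₗ[A] X, f = 0}

lemma isTorsionClass_leftPerp (X : Type) [AddCommGroup X] [Module A X] :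
    IsTorsionClass A (leftPerp (A := A) X) := by
  have key := isTorsionClass_finiteModules A
  have surj : ∀ (M N : ModuleCat.{0} A) (e : M →ₗ[A] N), Function.Surjective e →
      (∀ f : M →ₗ[A] X, f = 0) → ∀ f : N →ₗ[A] X, f = 0 := by
    intro M N e he h f
    ext y
    obtain ⟨x, rfl⟩ := he y
    exact LinearMap.congr_fun (h (f.comp e)) x
  refine ⟨fun M h => h.1, fun M h N ⟨e⟩ => ⟨key.2.1 M h.1 N ⟨e⟩, ?_⟩,
    fun M h N ⟨f, hf⟩ => ⟨key.2.2.1 M h.1 N ⟨f, hf⟩, surj M N f hf h.2⟩,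
    fun L E N f g hf hg hfg hL hN => ⟨key.2.2.2 L E N f g hf hg hfg hL.1 hN.1, fun u => ?_⟩⟩
  · exact surj M N e.toLinearMap e.surjective h.2
  · have h1 : LinearMap.ker g ≤ LinearMap.ker u := by
      rw [← hfg]
      rintro _ ⟨x, rfl⟩
      exact LinearMap.congr_fun (hL.2 (u.comp f)) x
    obtain ⟨v, hv⟩ := exists_comp_eq_of_ker_le hg u h1
    rw [← hv, hN.2 v, LinearMap.zero_comp]

lemma isTorsionClass_torsGen (U : ModuleCat.{0} A) [Module.Finite A U] :
    IsTorsionClass A (torsGen A U) := by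
  have h0 := isTorsionClass_finiteModules A
  refine ⟨fun M h => h _ ⟨h0, ‹_›⟩, fun M h N e T hT => hT.1.2.1 M (h T hT) N e,
    fun M h N e T hT => hT.1.2.2.1 M (h T hT) N e,
    fun L E N f g hf hg hfg hL hN T hT => hT.1.2.2.2 L E N f g hf hg hfg (hL T hT) (hN T hT)⟩

lemma self_mem_torsGen (U : ModuleCat.{0} A) : U ∈ torsGen A U := fun _ hT => hT.2

lemma exists_ne_zero_of_mem_torsGen (U : ModuleCat.{0} A) [Module.Finite A U]
    {X : Type} [AddCommGroup X] [Module A X] [Nontrivial X]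
    (hX : ModuleCat.of A X ∈ torsGen A U) : ∃ f : U →ₗ[A] X, f ≠ 0 := by
  by_contra! h
  have h1 : ModuleCat.of A X ∈ leftPerp (A := A) X :=
    hX _ ⟨isTorsionClass_leftPerp X, ‹_›, h⟩
  obtain ⟨x, hx⟩ := exists_ne (0 : X)
  exact hx (LinearMap.congr_fun (h1.2 LinearMap.id) x)

lemma surjective_of_isBrick {U V : ModuleCat.{0} A} [Module.Finite A U] [Module.Finite A V]
    (hV : IsBrick A V) (hUV : U ∈ torsGen A V) {f : U →ₗ[A] V} (hf : f ≠ 0) :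
    Function.Surjective f := by
  have hr : ModuleCat.of A (LinearMap.range f) ∈ torsGen A V :=
    (isTorsionClass_torsGen V).range_mem hUV f
  have : Nontrivial (LinearMap.range f) := by
    rw [Submodule.nontrivial_iff_ne_bot]
    exact fun h => hf (LinearMap.range_eq_bot.1 h)
  obtain ⟨g, hg⟩ := exists_ne_zero_of_mem_torsGen V hr
  have h2 : (LinearMap.range f).subtype.comp g ≠ 0 := by
    intro h
    apply hg
    ext x
    exact LinearMap.congr_fun h x
  intro y
  obtain ⟨x, hx⟩ := (hV.2 _ h2).2 y
  obtain ⟨z, hz⟩ := (g x).2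
  exact ⟨z, by rw [hz]; exact hx⟩

lemma nonempty_equiv_of_mem_torsGen {U V : ModuleCat.{0} A} [Module.Finite A U]
    [Module.Finite A V] (hU : IsBrick A U) (hV : IsBrick A V) (hUV : U ∈ torsGen A V)
    (hVU : V ∈ torsGen A U) : Nonempty (U ≃ₗ[A] V) := by
  have := hU.1
  have := hV.1
  obtain ⟨f, hf⟩ := exists_ne_zero_of_mem_torsGen (X := V) U hVU
  obtain ⟨g, hg⟩ := exists_ne_zero_of_mem_torsGen (X := U) V hUV
  have hfs := surjective_of_isBrick hV hUV hf
  have hgs := surjective_of_isBrick hU hVU hg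
  have hgf : g.comp f ≠ 0 := by
    intro h
    obtain ⟨x, hx⟩ := exists_ne (0 : U)
    obtain ⟨y, rfl⟩ := (hgs.comp hfs) x
    exact hx (LinearMap.congr_fun h y)
  have hinj : Function.Injective f := by
    have := (hU.2 _ hgf).1
    rw [LinearMap.coe_comp] at this
    exact this.of_comp
  exact ⟨LinearEquiv.ofBijective f ⟨hinj, hfs⟩⟩

/-- Inside a submodule `K` there is a largest submodule belonging to a torsion class. -/
lemma IsTorsionClass.exists_radical [IsNoetherianRing A] {T : Set (ModuleCat.{0} A)}
    (hT : IsTorsionClass A T) (hne : T.Nonempty) {M : Type} [AddCommGroup M] [Module A M]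
    [Module.Finite A M] (K : Submodule A M) :
    ∃ k ≤ K, ModuleCat.of A k ∈ T ∧ ∀ (E : Type) [AddCommGroup E] [Module A E],
      ModuleCat.of A E ∈ T → ∀ h : E →ₗ[A] M ⧸ k,
        LinearMap.range h ≤ K.map k.mkQ → h = 0 := by
  obtain ⟨N, hN⟩ := hne
  obtain ⟨k, ⟨hkK, hkT⟩, hmax⟩ := set_has_maximal_iff_noetherian.2
    (inferInstance : IsNoetherian A M) {k | k ≤ K ∧ ModuleCat.of A k ∈ T}
    ⟨⊥, bot_le, hT.subsingleton_mem (X := N) hN⟩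
  refine ⟨k, hkK, hkT, fun E _ _ hE h hr => ?_⟩
  set k2 := (LinearMap.range h).comap k.mkQ with hk2
  have hle : k ≤ k2 := fun x hx => by
    have : k.mkQ x = 0 := by simpa using hx
    rw [hk2, Submodule.mem_comap, this]; exact zero_mem _
  have hk2K : k2 ≤ K := by
    intro x hx
    obtain ⟨y, hy, hxy⟩ := hr hx
    have h3 : y - x ∈ k := (Submodule.Quotient.eq k).1 hxy
    simpa using sub_mem hy (hkK h3)
  have hk2T : ModuleCat.of A k2 ∈ T := by
    refine hT.mem_of_exact (Submodule.inclusion hle)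
      ((k.mkQ.comp k2.subtype).codRestrict (LinearMap.range h) fun x => Submodule.mem_comap.1 x.2)
      (Submodule.inclusion_injective hle) ?_ ?_ hkT (hT.range_mem hE h)
    · rintro ⟨y, hy⟩
      obtain ⟨x, rfl⟩ := k.mkQ_surjective y
      exact ⟨⟨x, hy⟩, rfl⟩
    · rw [LinearMap.ker_codRestrict, Submodule.range_inclusion, LinearMap.ker_comp,
        Submodule.ker_mkQ]
  have heq : k = k2 := by
    by_contra hne
    exact hmax k2 ⟨hk2K, hk2T⟩ (lt_of_le_of_ne hle hne)
  ext x
  obtain ⟨y, hy⟩ := k.mkQ_surjective (h x)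
  have : y ∈ k2 := by rw [hk2, Submodule.mem_comap, hy]; exact ⟨x, rfl⟩
  rw [← heq] at this
  rw [← hy]
  simpa using this

/-- Every element of a member of `T` is the image of `ι` under a homomorphism from `M`,
i.e. `A → M`, `1 ↦ ι` is a left `T`-approximation (when `M` lies in `T`). -/
def IsLeftApprox (T : Set (ModuleCat.{0} A)) {M : Type} [AddCommGroup M] [Module A M]
    (ι : M) : Prop :=
  ∀ (Y : Type) [AddCommGroup Y] [Module A Y], ModuleCat.of A Y ∈ T →
    ∀ y : Y, ∃ φ : M →ₗ[A] Y, φ ι = y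

/-- `M` lifts along surjections whose kernel lies in `T`. -/
def IsExtProjective (T : Set (ModuleCat.{0} A)) (M : Type) [AddCommGroup M]
    [Module A M] : Prop :=
  ∀ (Y Z : Type) [AddCommGroup Y] [Module A Y] [AddCommGroup Z] [Module A Z] (q : Y →ₗ[A] Z),
    Function.Surjective q → ModuleCat.of A (LinearMap.ker q) ∈ T →
      ∀ f : M →ₗ[A] Z, ∃ g : M →ₗ[A] Y, q.comp g = f

lemma IsExtProjective.prod {T : Set (ModuleCat.{0} A)} {M N : Type} [AddCommGroup M]
    [Module A M] [AddCommGroup N] [Module A N] (hM : IsExtProjective T M)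
    (hN : IsExtProjective T N) : IsExtProjective T (M × N) := by
  intro Y Z _ _ _ _ q hq hk f
  obtain ⟨g, hg⟩ := hM Y Z q hq hk (f.comp (LinearMap.inl A M N))
  obtain ⟨g', hg'⟩ := hN Y Z q hq hk (f.comp (LinearMap.inr A M N))
  refine ⟨g.coprod g', ?_⟩
  rw [LinearMap.comp_coprod, hg, hg', ← LinearMap.comp_coprod, LinearMap.coprod_inl_inr,
    LinearMap.comp_id]

/-- The cokernel of a left approximation by an Ext-projective module is Ext-projective. -/
lemma IsExtProjective.quotient_span {T : Set (ModuleCat.{0} A)} {M : Type} [AddCommGroup M]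
    [Module A M] {ι : M} (hM : IsExtProjective T M) (hι : IsLeftApprox T ι) :
    IsExtProjective T (M ⧸ Submodule.span A {ι}) := by
  intro Y Z _ _ _ _ q hq hk f
  obtain ⟨g, hg⟩ := hM Y Z q hq hk (f.comp (Submodule.mkQ _))
  have hz : q (g ι) = 0 := by
    have h1 : q (g ι) = f (Submodule.mkQ _ ι) := LinearMap.congr_fun hg ι
    have h2 : (Submodule.span A {ι}).mkQ ι = 0 := by
      simp
    rw [h1, h2, map_zero]
  obtain ⟨φ, hφ⟩ := hι _ hk ⟨g ι, hz⟩
  refine ⟨(Submodule.span A {ι}).liftQ (g - (LinearMap.ker q).subtype.comp φ) ?_, ?_⟩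
  · rw [Submodule.span_singleton_le_iff_mem]
    simp [hφ]
  · apply Submodule.linearMap_qext
    ext x
    have h1 : q (g x) = f (Submodule.mkQ _ x) := LinearMap.congr_fun hg x
    have h2 : q (φ x) = 0 := (φ x).2
    simp [h1, h2]

/-- A left approximation that is minimal, in the sense that every endomorphism fixing `ι` is
bijective, is Ext-projective (Wakamatsu's lemma). -/
lemma IsLeftApprox.isExtProjective {T : Set (ModuleCat.{0} A)} (hT : IsTorsionClass A T)
    {M : Type} [AddCommGroup M] [Module A M] {ι : M} (hι : IsLeftApprox T ι)
    (hM : ModuleCat.of A M ∈ T)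
    (hmin : ∀ e : M →ₗ[A] M, e ι = ι → Function.Bijective e) : IsExtProjective T M := by
  intro Y Z _ _ _ _ q hq hk f
  set E := LinearMap.ker (f.comp (LinearMap.fst A M Y) - q.comp (LinearMap.snd A M Y)) with hE
  have hmem : ∀ x : M × Y, x ∈ E ↔ f x.1 = q x.2 := by
    intro x
    simp [hE, LinearMap.mem_ker, sub_eq_zero]
  set pr : E →ₗ[A] M := (LinearMap.fst A M Y).comp E.subtype with hpr
  have hprs : Function.Surjective pr := by
    intro m
    obtain ⟨y, hy⟩ := hq (f m)
    exact ⟨⟨(m, y), (hmem _).2 hy.symm⟩, rfl⟩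
  have hET : ModuleCat.of A E ∈ T := by
    refine hT.mem_of_exact
      (((LinearMap.inr A M Y).comp (LinearMap.ker q).subtype).codRestrict E fun y => ?_)
      pr ?_ hprs ?_ hk hM
    · rw [hmem]
      have : q y = 0 := y.2
      simp [this]
    · intro a b hab
      have := congrArg (fun z : E => (z : M × Y).2) hab
      exact Subtype.ext this
    · ext ⟨⟨m, y⟩, hz⟩
      have hz' : f m = q y := (hmem _).1 hz
      constructor
      · rintro ⟨a, ha⟩
        have h3 := congrArg (fun z : E => (z : M × Y).1) ha
        exact h3.symm
      · intro h
        have hm : m = 0 := h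
        subst hm
        refine ⟨⟨y, ?_⟩, rfl⟩
        rw [LinearMap.mem_ker, ← hz', map_zero]
  obtain ⟨e, he⟩ := hprs ι
  obtain ⟨s, hs⟩ := hι E hET e
  have hb := hmin (pr.comp s) (by rw [LinearMap.comp_apply, hs, he])
  set u := LinearEquiv.ofBijective _ hb with hu
  refine ⟨((LinearMap.snd A M Y).comp E.subtype).comp (s.comp u.symm.toLinearMap), ?_⟩
  ext m
  have h1 := (hmem _).1 (s (u.symm m)).2
  have h2 : ((s (u.symm m) : E) : M × Y).1 = m := u.apply_symm_apply m
  rw [h2] at h1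
  simp [h1]

section Algebra

variable (K : Type) [Field K] [Algebra K A] [FiniteDimensional K A]

include K in
lemma exists_generating_element (N : Type) [AddCommGroup N] [Module A N] [Module.Finite A N] :
    ∃ (d : ℕ) (b : Fin d → N), ∀ y : N, ∃ φ : (Fin d → N) →ₗ[A] N, φ b = y := by
  let _ : Module K N := Module.compHom N (algebraMap K A)
  have : IsScalarTower K A N := ⟨fun c a x => by
    rw [Algebra.smul_def, mul_smul]; rfl⟩
  have : SMulCommClass A K N := IsScalarTower.to_smulCommClass'
  have : Module.Finite K N := Module.Finite.trans A N
  obtain ⟨d, b, hb⟩ := Module.Finite.exists_fin (R := K) (M := N)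
  refine ⟨d, b, fun y => ?_⟩
  have hy : y ∈ Submodule.span K (Set.range b) := hb ▸ Submodule.mem_top
  obtain ⟨c, hc⟩ := (Submodule.mem_span_range_iff_exists_fun K).1 hy
  exact ⟨∑ i, c i • LinearMap.proj i, by simpa using hc⟩

include K in
/-- A torsion class of the form `Fac N` has an Ext-projective left approximation of `A`. -/
lemma exists_extProjective_approx {T : Set (ModuleCat.{0} A)} (hT : IsTorsionClass A T)
    (N : ModuleCat.{0} A) [Module.Finite A N] (hTN : T = Fac A N) :
    ∃ (M : ModuleCat.{0} A) (ι : M), M ∈ T ∧ IsLeftApprox T ι ∧ IsExtProjective T M := by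
  have : IsArtinianRing A := IsArtinianRing.of_finite K A
  obtain ⟨d, b, hb⟩ := exists_generating_element (A := A) K N
  have hNT : N ∈ T := by
    rw [hTN]
    exact ⟨1, LinearMap.proj 0, fun y => ⟨fun _ => y, rfl⟩⟩
  have happ : IsLeftApprox T b := by
    intro Y _ _ hY y
    rw [hTN] at hY
    obtain ⟨k, f, hf⟩ := hY
    obtain ⟨z, rfl⟩ := hf y
    choose φ hφ using fun j => hb (z j)
    refine ⟨f.comp (LinearMap.pi φ), ?_⟩
    rw [LinearMap.comp_apply]
    congr 1
    ext j
    exact hφ j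
  obtain ⟨m, ⟨hbm, hmT, hma⟩, hmin⟩ := IsArtinian.set_has_minimal
    (R := A) (M := Fin d → N)
    {m | ∃ h : b ∈ m, ModuleCat.of A m ∈ T ∧ IsLeftApprox T (⟨b, h⟩ : m)}
    ⟨⊤, Submodule.mem_top, hT.mem_of_surjective (hT.pi_mem hNT d)
      Submodule.topEquiv.symm.toLinearMap Submodule.topEquiv.symm.surjective,
      fun Y _ _ hY y => by
        obtain ⟨φ, hφ⟩ := happ Y hY y
        exact ⟨φ.comp (Submodule.subtype _), hφ⟩⟩
  refine ⟨ModuleCat.of A m, ⟨b, hbm⟩, hmT, hma, hma.isExtProjective hT hmT fun e he => ?_⟩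
  have hle : LinearMap.range (m.subtype.comp e) ≤ m := by
    rintro _ ⟨x, rfl⟩
    exact (e x).2
  have hsurj : Function.Surjective e := by
    have hnot := hmin (LinearMap.range (m.subtype.comp e))
      ⟨⟨⟨b, hbm⟩, congrArg Subtype.val he⟩, hT.range_mem hmT _, fun Y _ _ hY y => by
        obtain ⟨φ, hφ⟩ := hma Y hY y
        exact ⟨φ.comp (Submodule.inclusion hle), hφ⟩⟩
    have heq : LinearMap.range (m.subtype.comp e) = m := by
      by_contra h
      exact hnot (lt_of_le_of_ne hle h)
    intro y
    obtain ⟨x, hx⟩ := heq.ge y.2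
    exact ⟨x, Subtype.ext hx⟩
  exact IsNoetherian.bijective_of_surjective_endomorphism e hsurj

/-- The `K`-vector space structure on `Hom_A(P, X)` for a `K`-algebra `A`. -/
@[reducible] noncomputable def homModule (P X : Type) [AddCommGroup P] [Module A P]
    [AddCommGroup X] [Module A X] : Module K (P →ₗ[A] X) :=
  letI : Module K X := Module.compHom X (algebraMap K A)
  haveI : IsScalarTower K A X := ⟨fun c a x => by
    rw [Algebra.smul_def, mul_smul]; rfl⟩
  haveI : SMulCommClass A K X := IsScalarTower.to_smulCommClass'
  LinearMap.module

attribute [local instance] homModule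

section Hom

variable (P : Type) [AddCommGroup P] [Module A P]
  {X Y Z : Type} [AddCommGroup X] [Module A X] [AddCommGroup Y] [Module A Y]
  [AddCommGroup Z] [Module A Z]

/-- Postcomposition as a `K`-linear map. -/
noncomputable def postcomp (f : X →ₗ[A] Y) : (P →ₗ[A] X) →ₗ[K] (P →ₗ[A] Y) where
  toFun g := f.comp g
  map_add' g h := LinearMap.comp_add g h f
  map_smul' c g := LinearMap.ext fun x => map_smul f (algebraMap K A c) (g x)

/-- Precomposition as a `K`-linear map. -/
noncomputable def precomp {P Q : Type} [AddCommGroup P] [Module A P] [AddCommGroup Q]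
    [Module A Q] (X : Type) [AddCommGroup X] [Module A X] (d : P →ₗ[A] Q) :
    (Q →ₗ[A] X) →ₗ[K] (P →ₗ[A] X) where
  toFun g := g.comp d
  map_add' g h := LinearMap.add_comp d h g
  map_smul' _ _ := rfl

variable (A) in
lemma finite_hom [Module.Finite A P] [Module.Finite A X] : Module.Finite K (P →ₗ[A] X) := by
  let _ : Module K X := Module.compHom X (algebraMap K A)
  have : IsScalarTower K A X := ⟨fun c a x => by
    rw [Algebra.smul_def, mul_smul]; rfl⟩
  have : Module.Finite K X := Module.Finite.trans A X
  obtain ⟨r, b, hb⟩ := Module.Finite.exists_fin (R := A) (M := P)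
  let ev : (P →ₗ[A] X) →ₗ[K] (Fin r → X) :=
    { toFun := fun f i => f (b i)
      map_add' := fun f g => rfl
      map_smul' := fun c f => rfl }
  refine Module.Finite.of_injective ev fun f g hfg => ?_
  refine LinearMap.ext_on_range (v := b) hb fun i => ?_
  exact congrFun hfg i

variable (A) in
/-- The `K`-dimension of `Hom_A(P, X)`. -/
noncomputable def homDim (X : Type) [AddCommGroup X] [Module A X] : ℕ :=
  Module.finrank K (P →ₗ[A] X)

variable {P} in
lemma homDim_pos [Module.Finite A P] [Module.Finite A X] {f : P →ₗ[A] X} (hf : f ≠ 0) :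
    0 < homDim A K P X := by
  have := finite_hom A K P (X := X)
  have : Nontrivial (P →ₗ[A] X) := ⟨f, 0, hf⟩
  exact Module.finrank_pos

lemma homDim_eq_add [Module.Projective A P] [Module.Finite A P] [Module.Finite A Y]
    (f : X →ₗ[A] Y) (g : Y →ₗ[A] Z) (hf : Function.Injective f) (hg : Function.Surjective g)
    (hfg : LinearMap.range f = LinearMap.ker g) :
    homDim A K P Y = homDim A K P X + homDim A K P Z := by
  have := finite_hom A K P (X := Y)
  have h1 : LinearMap.range (postcomp K P g) = ⊤ := by
    rw [LinearMap.range_eq_top]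
    intro h
    exact Module.projective_lifting_property g h hg
  have h2 : LinearMap.range (postcomp K P f) = LinearMap.ker (postcomp K P g) := by
    ext h
    constructor
    · rintro ⟨u, rfl⟩
      ext x
      have h3 : f (u x) ∈ LinearMap.ker g := hfg ▸ LinearMap.mem_range_self f (u x)
      exact h3
    · intro hh
      have h3 : ∀ x, h x ∈ LinearMap.range f := fun x => by
        rw [hfg]
        exact LinearMap.congr_fun hh x
      refine ⟨(LinearEquiv.ofInjective f hf).symm.toLinearMap.comp
        (h.codRestrict (LinearMap.range f) h3), ?_⟩
      ext x
      exact congrArg Subtype.val ((LinearEquiv.ofInjective f hf).apply_symm_apply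
        (h.codRestrict (LinearMap.range f) h3 x))
  have h4 : Function.Injective (postcomp K P f) := by
    intro u v huv
    ext x
    exact hf (LinearMap.congr_fun huv x)
  have h5 := (postcomp K P g).finrank_range_add_finrank_ker
  rw [h1, finrank_top, ← h2, LinearMap.finrank_range_of_inj h4] at h5
  unfold homDim
  omega

omit [FiniteDimensional K A] in
lemma homDim_congr (e : X ≃ₗ[A] Y) : homDim A K P X = homDim A K P Y := by
  refine LinearEquiv.finrank_eq (LinearEquiv.ofBijective (postcomp K P e.toLinearMap) ⟨?_, ?_⟩)
  · intro u v huv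
    ext x
    exact e.injective (LinearMap.congr_fun huv x)
  · intro u
    refine ⟨e.symm.toLinearMap.comp u, ?_⟩
    ext x
    exact e.apply_symm_apply (u x)

include K in
/-- Right approximations by powers of `P`. -/
lemma exists_right_approx [Module.Finite A P] (X : Type) [AddCommGroup X] [Module A X]
    [Module.Finite A X] : ∃ (r : ℕ) (p : (Fin r → P) →ₗ[A] X),
      ∀ f : P →ₗ[A] X, ∃ h : P →ₗ[A] (Fin r → P), p.comp h = f := by
  have := finite_hom A K P (X := X)
  obtain ⟨r, b, hb⟩ := Module.Finite.exists_fin (R := K) (M := P →ₗ[A] X)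
  refine ⟨r, ∑ i, (b i).comp (LinearMap.proj i), fun f => ?_⟩
  have hf : f ∈ Submodule.span K (Set.range b) := hb ▸ Submodule.mem_top
  obtain ⟨c, hc⟩ := (Submodule.mem_span_range_iff_exists_fun K).1 hf
  refine ⟨LinearMap.pi fun i => c i • LinearMap.id, ?_⟩
  rw [← hc]
  ext x
  simp only [LinearMap.comp_apply, LinearMap.sum_apply]
  exact Finset.sum_congr rfl fun i _ => map_smul (b i) (algebraMap K A (c i)) x

end Hom

include K in
/-- If `T ⊊ T'` and `M` is an Ext-projective member of `T'`, then `T'` contains a module `X`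
without maps from `T` such that `Hom(M, X)` is a simple (or zero)
`End(M)`-module. -/
lemma exists_hom_simple {T T' : Set (ModuleCat.{0} A)} (hT : IsTorsionClass A T)
    (hT' : IsTorsionClass A T') (hne : T.Nonempty) (hle : T ⊆ T') (hlt : ¬ T' ⊆ T)
    (M : Type) [AddCommGroup M] [Module A M] (hM : ModuleCat.of A M ∈ T')
    (hproj : IsExtProjective T' M) :
    ∃ X : ModuleCat.{0} A, Nontrivial X ∧ X ∈ T' ∧
      (∀ E : ModuleCat.{0} A, E ∈ T → ∀ f : E →ₗ[A] X, f = 0) ∧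
      ∀ f g : M →ₗ[A] X, f ≠ 0 → ∃ e : M →ₗ[A] M, f.comp e = g := by
  have : IsNoetherianRing A := IsNoetherianRing.of_finite K A
  have hMf : Module.Finite A M := hT'.1 _ hM
  obtain ⟨Y, hYT', hYT⟩ := Set.not_subset.1 hlt
  have hYf : Module.Finite A Y := hT'.1 _ hYT'
  set S : Set (ModuleCat.{0} A) := {X | Nontrivial X ∧ X ∈ T' ∧
    ∀ E : ModuleCat.{0} A, E ∈ T → ∀ f : E →ₗ[A] X, f = 0} with hS
  have hSne : S.Nonempty := by
    obtain ⟨k, -, hkT, hk⟩ := hT.exists_radical hne (⊤ : Submodule A Y)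
    refine ⟨ModuleCat.of A (Y ⧸ k), ?_, hT'.mem_of_surjective hYT' k.mkQ k.mkQ_surjective,
      fun E hE f => hk E hE f ?_⟩
    · rw [Submodule.Quotient.nontrivial_iff]
      rintro rfl
      exact hYT (hT.mem_of_surjective hkT Submodule.topEquiv.toLinearMap
        Submodule.topEquiv.surjective)
    · rw [Submodule.map_top, Submodule.range_mkQ]
      exact le_top
  obtain ⟨X, ⟨hX, hXT', hXT⟩, hmin⟩ :=
    (measure fun X : ModuleCat.{0} A => homDim A K M X).wf.has_min S hSne
  refine ⟨X, hX, hXT', hXT, fun f g hf => ?_⟩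
  obtain ⟨k, hkf, hkT', hk⟩ := hT'.exists_radical (hne.mono hle) (LinearMap.ker f)
  set f' : M ⧸ k →ₗ[A] X := k.liftQ f hkf with hf'
  have hker : ∀ (E : Type) [AddCommGroup E] [Module A E], ModuleCat.of A E ∈ T' →
      ∀ h : E →ₗ[A] M ⧸ k, f'.comp h = 0 → h = 0 := by
    intro E _ _ hE h h0
    refine hk E hE h ?_
    rintro _ ⟨x, rfl⟩
    obtain ⟨m, hm⟩ := k.mkQ_surjective (h x)
    refine ⟨m, ?_, hm⟩
    have h1 : f' (h x) = 0 := LinearMap.congr_fun h0 x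
    rw [← hm] at h1
    simpa [hf'] using h1
  have hXS : ModuleCat.of A (M ⧸ k) ∈ S := by
    refine ⟨?_, hT'.mem_of_surjective hM k.mkQ k.mkQ_surjective, fun E hE h =>
      hker E (hle hE) h (hXT E hE _)⟩
    rw [Submodule.Quotient.nontrivial_iff]
    rintro rfl
    apply hf
    ext x
    exact hkf Submodule.mem_top
  have hdim : homDim A K M X ≤ homDim A K M (M ⧸ k) := not_lt.1 (hmin _ hXS)
  have hXf : Module.Finite A X := hT'.1 _ hXT'
  have := finite_hom A K M (X := X)
  have := finite_hom A K M (X := M ⧸ k)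
  have hinj : Function.Injective (postcomp K M f') := by
    rw [← LinearMap.ker_eq_bot, LinearMap.ker_eq_bot']
    exact fun h h0 => hker M hM h h0
  have hsurj : Function.Surjective (postcomp K M f') :=
    (LinearMap.injective_iff_surjective_of_finrank_eq_finrank
      (le_antisymm (LinearMap.finrank_le_finrank_of_injective hinj) hdim)).1 hinj
  obtain ⟨h, hh⟩ := hsurj g
  obtain ⟨e, he⟩ := hproj M (M ⧸ k) k.mkQ k.mkQ_surjective (by rwa [Submodule.ker_mkQ]) h
  refine ⟨e, ?_⟩
  rw [← hh, ← he]
  ext x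
  rfl

/-- If `p : P → E` is surjective and every `x ∈ ker p` can be reached from `M`, where `Hom(M, X)`
is simple over `End(M)`, and there are no maps `E → X`, then `p` stays surjective on
the image of an endomorphism of `P` admitting no maps to `X`. -/
lemma exists_endomorphism_range_perp [IsArtinianRing A] {P M E X : Type}
    [AddCommGroup P] [Module A P] [Module.Finite A P] [AddCommGroup M] [Module A M]
    [AddCommGroup E] [Module A E] [AddCommGroup X] [Module A X] (p : P →ₗ[A] E)
    (hp : Function.Surjective p) (hEX : ∀ f : E →ₗ[A] X, f = 0)
    (hker : ∀ x, p x = 0 → ∃ (φ : M →ₗ[A] P), p.comp φ = 0 ∧ x ∈ LinearMap.range φ)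
    (hsimple : ∀ (f : M →ₗ[A] X) (g : P →ₗ[A] X), f ≠ 0 → ∃ e : P →ₗ[A] M, f.comp e = g) :
    ∃ e : P →ₗ[A] P, p.comp e = p ∧ ∀ g : LinearMap.range e →ₗ[A] X, g = 0 := by
  obtain ⟨R, ⟨e, hpe, rfl⟩, hmin⟩ := IsArtinian.set_has_minimal (R := A) (M := P)
    {R | ∃ e : P →ₗ[A] P, p.comp e = p ∧ LinearMap.range e = R}
    ⟨_, LinearMap.id, LinearMap.comp_id p, rfl⟩
  refine ⟨e, hpe, fun g => ?_⟩
  by_contra hg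
  have hpe' : ∀ x, p (e x) = p x := LinearMap.congr_fun hpe
  set g' : P →ₗ[A] X := g.comp e.rangeRestrict with hg'
  have hx : ∃ x, p x = 0 ∧ g' x ≠ 0 := by
    by_contra! hx
    obtain ⟨v, hv⟩ := exists_comp_eq_of_ker_le hp g' fun x h => hx x h
    apply hg
    ext ⟨_, y, rfl⟩
    have h1 : g' y = 0 := by rw [← hv, hEX v, LinearMap.zero_comp, LinearMap.zero_apply]
    exact h1
  obtain ⟨x, hx0, hgx⟩ := hx
  obtain ⟨φ, hpφ, m, rfl⟩ := hker x hx0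
  obtain ⟨h, hh⟩ := hsimple (g'.comp φ) g' fun h0 => hgx (LinearMap.congr_fun h0 m)
  set e' := e.comp (LinearMap.id - φ.comp h) with he'
  have hpe1 : p.comp e' = p := by
    ext y
    have : p (φ (h y)) = 0 := LinearMap.congr_fun hpφ (h y)
    simp [he', hpe', this]
  have hle : LinearMap.range e' ≤ LinearMap.range e := LinearMap.range_comp_le_range _ _
  refine hmin _ ⟨e', hpe1, rfl⟩ (lt_of_le_of_ne hle fun heq => hg ?_)
  ext ⟨z, hz⟩
  obtain ⟨y, rfl⟩ := heq.ge hz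
  have h1 : g' (φ (h y)) = g' y := LinearMap.congr_fun hh y
  have h2 : g' (y - φ (h y)) = 0 := by rw [map_sub, h1, sub_self]
  exact h2

/-- If `Hom(M, X)` is simple over `End(M)`, maps from powers of `M` to `X` factor through
any nonzero map `M → X`. -/
lemma exists_comp_eq_pi {M X : Type} [AddCommGroup M] [Module A M] [AddCommGroup X] [Module A X]
    (hsimple : ∀ f g : M →ₗ[A] X, f ≠ 0 → ∃ e : M →ₗ[A] M, f.comp e = g) {r : ℕ}
    (f : M →ₗ[A] X) (g : (Fin r → M) →ₗ[A] X) (hf : f ≠ 0) :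
    ∃ e : (Fin r → M) →ₗ[A] M, f.comp e = g := by
  choose a ha using fun i => hsimple f (g.comp (LinearMap.single A (fun _ : Fin r => M) i)) hf
  refine ⟨∑ i, (a i).comp (LinearMap.proj i), LinearMap.ext fun x => ?_⟩
  have h1 : ∀ i, f (a i (x i)) = g (Pi.single i (x i)) := fun i => LinearMap.congr_fun (ha i) (x i)
  rw [LinearMap.comp_apply, LinearMap.sum_apply, map_sum]
  simp only [LinearMap.comp_apply, LinearMap.proj_apply, h1]
  rw [← map_sum, Finset.univ_sum_single]

/-- Elements of the kernel of a right approximation by `M × coker ι` can be reached from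
`M` by maps into the kernel. -/
lemma IsLeftApprox.exists_comp_eq_zero {T : Set (ModuleCat.{0} A)} {M P E : Type}
    [AddCommGroup M] [Module A M] [AddCommGroup P] [Module A P] [AddCommGroup E] [Module A E]
    {ι : M} (hι : IsLeftApprox T ι) (hP : ModuleCat.of A P ∈ T) (p : P →ₗ[A] E)
    (hp : ∀ f : M × (M ⧸ Submodule.span A {ι}) →ₗ[A] E,
      ∃ h : M × (M ⧸ Submodule.span A {ι}) →ₗ[A] P, p.comp h = f)
    {x : P} (hx : p x = 0) :
    ∃ ψ : M × (M ⧸ Submodule.span A {ι}) →ₗ[A] P, p.comp ψ = 0 ∧ x ∈ LinearMap.range ψ := by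
  obtain ⟨φ, hφ⟩ := hι P hP x
  have hspan : Submodule.span A {ι} ≤ LinearMap.ker (p.comp φ) := by
    rw [Submodule.span_singleton_le_iff_mem, LinearMap.mem_ker, LinearMap.comp_apply, hφ, hx]
  obtain ⟨χ, hχ⟩ := hp (((Submodule.span A {ι}).liftQ (p.comp φ) hspan).comp
    (LinearMap.snd A M _))
  have hχ' : ∀ m : M, p (χ (0, (Submodule.span A {ι}).mkQ m)) = p (φ m) := fun m =>
    LinearMap.congr_fun hχ (0, (Submodule.span A {ι}).mkQ m)
  have hι0 : (Submodule.span A {ι}).mkQ ι = 0 :=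
    (Submodule.Quotient.mk_eq_zero _).2 (Submodule.mem_span_singleton_self ι)
  refine ⟨(φ - χ.comp ((LinearMap.inr A M _).comp (Submodule.span A {ι}).mkQ)).comp
    (LinearMap.fst A M _), LinearMap.ext fun m => ?_, (ι, 0), ?_⟩
  · exact (map_sub p _ _).trans (sub_eq_zero.2 (hχ' m.1).symm)
  · have h1 : χ (0, (Submodule.span A {ι}).mkQ ι) = 0 := by rw [hι0]; exact map_zero χ
    exact (congrArg₂ (· - ·) hφ h1).trans (sub_zero x)

include K in
/-- Below a torsion class `Fac N` strictly containing `T` there is a smaller one of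
the same form that still contains `T`. -/
lemma exists_fac_ssubset {T T' : Set (ModuleCat.{0} A)} (hT : IsTorsionClass A T)
    (hT' : IsTorsionClass A T') (hne : T.Nonempty) (hle : T ⊆ T') (hlt : ¬ T' ⊆ T)
    (N : ModuleCat.{0} A) [Module.Finite A N] (hN : T' = Fac A N) :
    ∃ (T'' : Set (ModuleCat.{0} A)) (N' : ModuleCat.{0} A), IsTorsionClass A T'' ∧
      Module.Finite A N' ∧ T'' = Fac A N' ∧ T ⊆ T'' ∧ T'' ⊆ T' ∧ ¬ T' ⊆ T'' := by
  have : IsNoetherianRing A := IsNoetherianRing.of_finite K A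
  have : IsArtinianRing A := IsArtinianRing.of_finite K A
  obtain ⟨M₀, ι, hM₀, hι, hproj₀⟩ := exists_extProjective_approx K hT' N hN
  let M₁ := M₀ ⧸ Submodule.span A {ι}
  let q : M₀ →ₗ[A] M₁ := Submodule.mkQ _
  have hM₁ : ModuleCat.of A M₁ ∈ T' := hT'.mem_of_surjective hM₀ q (Submodule.mkQ_surjective _)
  let M := M₀ × M₁
  have hM : ModuleCat.of A M ∈ T' := hT'.prod_mem hM₀ hM₁
  have hproj : IsExtProjective T' M := hproj₀.prod (hproj₀.quotient_span hι)
  have hMf : Module.Finite A M := hT'.1 _ hM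
  have happ : ∀ (X : ModuleCat.{0} A), X ∈ T' → ∀ x : X, ∃ f : M →ₗ[A] X, f (ι, 0) = x := by
    intro X hX x
    obtain ⟨φ, hφ⟩ := hι X hX x
    exact ⟨φ.comp (LinearMap.fst A M₀ M₁), hφ⟩
  obtain ⟨X, hX, hXT', hXT, hsimple⟩ := exists_hom_simple K hT hT' hne hle hlt M hM hproj
  set T'' := T' ∩ leftPerp (A := A) X with hT''def
  have hT'' : IsTorsionClass A T'' := hT'.inter (isTorsionClass_leftPerp X)
  have hTT'' : T ⊆ T'' := fun E hE => ⟨hle hE, hT.1 E hE, hXT E hE⟩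
  obtain ⟨k, -, hkT, hk⟩ := hT''.exists_radical (hne.mono hTT'') (⊤ : Submodule A M)
  have hkmax : ∀ (E : Type) [AddCommGroup E] [Module A E], ModuleCat.of A E ∈ T'' →
      ∀ (h : E →ₗ[A] M) (x : E), h x ∈ k := by
    intro E _ _ hE h x
    have h0 := hk E hE (k.mkQ.comp h) (by
      rw [Submodule.map_top, Submodule.range_mkQ]
      exact le_top)
    simpa using LinearMap.congr_fun h0 x
  refine ⟨T'', ModuleCat.of A k, hT'', hT''.1 _ hkT, ?_, hTT'', Set.inter_subset_left, ?_⟩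
  · refine (Set.Subset.antisymm (fun E hE => ?_) (hT''.fac_subset hkT))
    have hEf : Module.Finite A E := hT'.1 _ hE.1
    obtain ⟨r, p, hp⟩ := exists_right_approx (A := A) K M E
    have hps : Function.Surjective p := by
      intro y
      obtain ⟨f, hf⟩ := happ E hE.1 y
      obtain ⟨h, hh⟩ := hp f
      exact ⟨h (ι, 0), by rw [← hf, ← hh]; rfl⟩
    have hPT' : ModuleCat.of A (Fin r → M) ∈ T' := hT'.pi_mem hM r
    obtain ⟨e, hpe, he⟩ := exists_endomorphism_range_perp (M := M) p hps hE.2.2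
      (fun x hx => hι.exists_comp_eq_zero hPT' p hp hx)
      (fun f g hf => exists_comp_eq_pi hsimple f g hf)
    have hrT : ModuleCat.of A (LinearMap.range e) ∈ T'' :=
      ⟨hT'.range_mem hPT' e, hT'.1 _ (hT'.range_mem hPT' e), he⟩
    refine ⟨r, p.comp (LinearMap.pi fun i => k.subtype.comp (LinearMap.proj i)), fun y => ?_⟩
    obtain ⟨z, rfl⟩ := hps y
    refine ⟨fun i => ⟨e z i, hkmax _ hrT
      ((LinearMap.proj i).comp (LinearMap.range e).subtype) ⟨e z, z, rfl⟩⟩, ?_⟩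
    exact LinearMap.congr_fun hpe z
  · intro hsub
    obtain ⟨x, hx⟩ := exists_ne (0 : X)
    exact hx (LinearMap.congr_fun ((hsub hXT').2.2 LinearMap.id) x)

include K in
/-- If there are finitely many torsion classes, each of them is of the form `Fac N`. -/
lemma exists_eq_fac (hfin : {T : Set (ModuleCat.{0} A) | IsTorsionClass A T}.Finite)
    {T : Set (ModuleCat.{0} A)} (hT : IsTorsionClass A T) (hne : T.Nonempty) :
    ∃ N : ModuleCat.{0} A, Module.Finite A N ∧ T = Fac A N := by
  set F : Set (Set (ModuleCat.{0} A)) := {T' | IsTorsionClass A T' ∧ T ⊆ T' ∧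
    ∃ N : ModuleCat.{0} A, Module.Finite A N ∧ T' = Fac A N}
  have hF : F.Finite := hfin.subset fun T' h => h.1
  have hFne : F.Nonempty := by
    refine ⟨finiteModules A, isTorsionClass_finiteModules A, fun M hM => hT.1 M hM,
      ModuleCat.of A A, inferInstanceAs (Module.Finite A A), Set.Subset.antisymm ?_
        ((isTorsionClass_finiteModules A).fac_subset (inferInstanceAs (Module.Finite A A)))⟩
    intro M hM
    have : Module.Finite A M := hM
    obtain ⟨k, f, hf⟩ := Module.Finite.exists_fin' A M
    exact ⟨k, f, hf⟩
  obtain ⟨T', ⟨hT', hle, N, hNf, hN⟩, hmin⟩ := hF.exists_minimal hFne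
  by_cases h : T' ⊆ T
  · exact ⟨N, hNf, (Set.Subset.antisymm hle h).trans hN⟩
  · obtain ⟨T'', N', hT'', hN'f, hN', h1, h2, h3⟩ := exists_fac_ssubset K hT hT' hne hle h N hN
    exact absurd (hmin ⟨hT'', h1, N', hN'f, hN'⟩ h2) h3

/-- Finitely generated modules over an artinian ring have projective covers. -/
lemma exists_projective_cover [IsArtinianRing A] (W : Type) [AddCommGroup W] [Module A W]
    [Module.Finite A W] :
    ∃ (P : ModuleCat.{0} A) (c : P →ₗ[A] W), Module.Finite A P ∧ Module.Projective A P ∧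
      Function.Surjective c ∧
      ∀ N : Submodule A P, N ⊔ LinearMap.ker c = ⊤ → N = ⊤ := by
  obtain ⟨s, c₀, hc₀⟩ := Module.Finite.exists_fin' A W
  obtain ⟨R, ⟨e, hce, rfl⟩, hmin⟩ := IsArtinian.set_has_minimal (R := A) (M := Fin s → A)
    {R | ∃ e : (Fin s → A) →ₗ[A] (Fin s → A), c₀.comp e = c₀ ∧ LinearMap.range e = R}
    ⟨_, LinearMap.id, LinearMap.comp_id c₀, rfl⟩
  have hce' : ∀ x, c₀ (e x) = c₀ x := LinearMap.congr_fun hce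
  have hmin' : ∀ e' : (Fin s → A) →ₗ[A] (Fin s → A), c₀.comp e' = c₀ →
      LinearMap.range e' ≤ LinearMap.range e → LinearMap.range e ≤ LinearMap.range e' := by
    intro e' h1 h2
    by_contra h3
    exact hmin _ ⟨e', h1, rfl⟩ (lt_of_le_not_ge h2 h3)
  set P := LinearMap.range e with hP
  have hsurj : Function.Surjective (e.rangeRestrict.comp P.subtype) := by
    rintro ⟨y, hy⟩
    obtain ⟨x, hx⟩ := hmin' (e.comp e) (by rw [← LinearMap.comp_assoc, hce, hce])
      (LinearMap.range_comp_le_range _ _) hy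
    exact ⟨⟨e x, x, rfl⟩, Subtype.ext hx⟩
  set u := LinearEquiv.ofBijective _
    (IsNoetherian.bijective_of_surjective_endomorphism _ hsurj) with hu
  refine ⟨ModuleCat.of A P, c₀.comp P.subtype, inferInstanceAs (Module.Finite A P),
    Module.Projective.of_split (P.subtype.comp u.symm.toLinearMap) e.rangeRestrict
      (LinearMap.ext fun x => u.apply_symm_apply x), fun w => ?_, fun N hN => ?_⟩
  · obtain ⟨x, rfl⟩ := hc₀ w
    exact ⟨⟨e x, x, rfl⟩, hce' x⟩
  · have hNs : Function.Surjective ((c₀.comp P.subtype).comp N.subtype) := by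
      intro w
      obtain ⟨x, rfl⟩ := hc₀ w
      obtain ⟨y, hy, z, hz, hyz⟩ := Submodule.mem_sup.1
        (hN.ge (Submodule.mem_top (x := (⟨e x, x, rfl⟩ : P))))
      refine ⟨⟨y, hy⟩, ?_⟩
      have h1 : c₀ (y + z : P) = c₀ (e x) := by rw [hyz]
      have h2 : c₀ (z : P) = 0 := hz
      rw [Submodule.coe_add, map_add, h2, add_zero, hce'] at h1
      exact h1
    obtain ⟨h, hh⟩ := Module.projective_lifting_property _ c₀ hNs
    have hle := hmin' (P.subtype.comp (N.subtype.comp h)) hh (by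
      rintro _ ⟨x, rfl⟩
      exact (h x : P).2)
    rw [eq_top_iff]
    rintro ⟨y, hy⟩ -
    obtain ⟨x, hx⟩ := hle hy
    have h3 : (h x : P) = ⟨y, hy⟩ := Subtype.ext hx
    exact h3 ▸ (h x).2

/-- Let `M` be an Ext-projective member of `T` with a minimal presentation `d : P₁ → P₀`. Every
map from `P₁` to a member of `T` extends along `d`. -/
lemma IsExtProjective.exists_comp_eq {T : Set (ModuleCat.{0} A)} (hT : IsTorsionClass A T)
    {M P₀ P₁ X : Type} [AddCommGroup M] [Module A M] [AddCommGroup P₀] [Module A P₀]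
    [AddCommGroup P₁] [Module A P₁] [AddCommGroup X] [Module A X] (hM : IsExtProjective T M)
    (hX : ModuleCat.of A X ∈ T) (π : P₀ →ₗ[A] M) (hπ : Function.Surjective π)
    [Module.Projective A P₀] (d : P₁ →ₗ[A] P₀) (hd : LinearMap.range d = LinearMap.ker π)
    (hmin : ∀ N : Submodule A P₁, N ⊔ LinearMap.ker d = ⊤ → N = ⊤) (f : P₁ →ₗ[A] X) :
    ∃ g : P₀ →ₗ[A] X, g.comp d = f := by
  have hπd : ∀ k, π (d k) = 0 := fun k => hd.le ⟨k, rfl⟩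
  set R : Submodule A (P₀ × X) := LinearMap.range (d.prod f) with hR
  set j : X →ₗ[A] (P₀ × X) ⧸ R := R.mkQ.comp (LinearMap.inr A P₀ X) with hj
  have hRle : R ≤ LinearMap.ker (π.comp (LinearMap.fst A P₀ X)) := by
    rintro _ ⟨k, rfl⟩
    exact hπd k
  set q : (P₀ × X) ⧸ R →ₗ[A] M := R.liftQ _ hRle with hq
  have hqmk : ∀ p x, q (R.mkQ (p, x)) = π p := fun p x => rfl
  have hmk0 : ∀ k, R.mkQ (d k, f k) = 0 := fun k => (Submodule.Quotient.mk_eq_zero _).2 ⟨k, rfl⟩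
  have hqs : Function.Surjective q := fun m => by
    obtain ⟨p, rfl⟩ := hπ m
    exact ⟨R.mkQ (p, 0), rfl⟩
  have hker : LinearMap.ker q ≤ LinearMap.range j := by
    intro z hz
    obtain ⟨⟨p, x⟩, rfl⟩ := R.mkQ_surjective z
    obtain ⟨k, rfl⟩ := hd.ge (show π p = 0 from hz)
    refine ⟨x - f k, ?_⟩
    have h1 : ((0 : P₀), x - f k) = (d k, x) - (d k, f k) := by simp
    change R.mkQ (0, x - f k) = _
    rw [h1, map_sub, hmk0, sub_zero]
  have hker' : LinearMap.range j ≤ LinearMap.ker q := by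
    rintro _ ⟨x, rfl⟩
    exact map_zero π
  obtain ⟨s, hs⟩ := hM _ _ q hqs (by
    rw [← le_antisymm hker' hker]
    exact hT.range_mem hX j) LinearMap.id
  have hs' : ∀ m, q (s m) = m := LinearMap.congr_fun hs
  set u : P₀ →ₗ[A] (P₀ × X) ⧸ R := R.mkQ.comp (LinearMap.inl A P₀ X) - s.comp π with hu
  have hu' : ∀ p, u p ∈ LinearMap.range j := fun p => hker (by
    rw [LinearMap.mem_ker]
    change q (R.mkQ (p, 0) - s (π p)) = 0
    rw [map_sub, hs', hqmk, sub_self])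
  obtain ⟨g, hg⟩ := Module.projective_lifting_property j.rangeRestrict
    (u.codRestrict (LinearMap.range j) hu') j.surjective_rangeRestrict
  have hg' : ∀ p, j (g p) = u p := fun p => congrArg Subtype.val (LinearMap.congr_fun hg p)
  set f' : P₁ →ₗ[A] X := g.comp d + f with hf'
  have hjf : ∀ k, j (f' k) = 0 := by
    intro k
    have h1 : u (d k) = R.mkQ (d k, 0) := by
      change R.mkQ (d k, 0) - s (π (d k)) = _
      rw [hπd, map_zero, sub_zero]
    change j (g (d k) + f k) = 0
    rw [map_add, hg', h1]
    change R.mkQ (d k, 0) + R.mkQ (0, f k) = 0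
    rw [← map_add, ← hmk0 k]
    simp
  have htop : LinearMap.ker f' ⊔ LinearMap.ker d = ⊤ := by
    rw [eq_top_iff]
    intro k _
    obtain ⟨l, hl⟩ := (Submodule.Quotient.mk_eq_zero R).1 (hjf k)
    have h1 : d l = 0 := congrArg Prod.fst hl
    have h2 : f l = f' k := congrArg Prod.snd hl
    have h3 : f' l = f' k := by
      rw [← h2]
      change g (d l) + f l = f l
      rw [h1, map_zero, zero_add]
    refine Submodule.mem_sup.2 ⟨k - l, ?_, l, h1, sub_add_cancel k l⟩
    rw [LinearMap.mem_ker, map_sub, h3, sub_self]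
  have hf0 : f' = 0 := LinearMap.ker_eq_top.1 (hmin _ htop)
  refine ⟨-g, ?_⟩
  rw [LinearMap.neg_comp]
  exact neg_eq_of_add_eq_zero_right hf0

/-- A functorially finite torsion class is detected by a pair of projective modules. -/
lemma exists_projective_homDim {T : Set (ModuleCat.{0} A)} (hT : IsTorsionClass A T)
    (N : ModuleCat.{0} A) [Module.Finite A N] (hN : T = Fac A N) :
    ∃ P₀ P₁ : ModuleCat.{0} A, Module.Finite A P₀ ∧ Module.Projective A P₀ ∧
      Module.Finite A P₁ ∧ Module.Projective A P₁ ∧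
      (∀ X : ModuleCat.{0} A, X ∈ T → Nontrivial X → homDim A K P₁ X < homDim A K P₀ X) ∧
      (∀ X : ModuleCat.{0} A, Module.Finite A X →
        (∀ E : ModuleCat.{0} A, E ∈ T → ∀ f : E →ₗ[A] X, f = 0) →
        homDim A K P₀ X ≤ homDim A K P₁ X) := by
  have : IsNoetherianRing A := IsNoetherianRing.of_finite K A
  have : IsArtinianRing A := IsArtinianRing.of_finite K A
  obtain ⟨M, ι, hM, hι, hproj⟩ := exists_extProjective_approx K hT N hN
  have hMf : Module.Finite A M := hT.1 _ hM
  obtain ⟨r, π, hπ⟩ := Module.Finite.exists_fin' A M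
  obtain ⟨P₁, c, hP₁f, hP₁, hc, hmin⟩ := exists_projective_cover (A := A) (LinearMap.ker π)
  set d : P₁ →ₗ[A] (Fin r → A) := (LinearMap.ker π).subtype.comp c with hd
  have hdr : LinearMap.range d = LinearMap.ker π := by
    rw [hd, LinearMap.range_comp, LinearMap.range_eq_top.2 hc, Submodule.map_top,
      Submodule.range_subtype]
  have hdk : LinearMap.ker d = LinearMap.ker c := by
    rw [hd, LinearMap.ker_comp, Submodule.ker_subtype, Submodule.comap_bot]
  refine ⟨ModuleCat.of A (Fin r → A), P₁, inferInstanceAs (Module.Finite A (Fin r → A)),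
    inferInstanceAs (Module.Projective A (Fin r → A)), hP₁f, hP₁, fun X hX hXn => ?_,
    fun X hXf hX => ?_⟩
  · have hXf : Module.Finite A X := hT.1 _ hX
    have := finite_hom A K (Fin r → A) (X := X)
    have h1 : LinearMap.range (precomp K X d) = ⊤ := LinearMap.range_eq_top.2 fun f =>
      hproj.exists_comp_eq hT hX π hπ d hdr (fun N hN => hmin N (hdk ▸ hN)) f
    have h2 := (precomp K X d).finrank_range_add_finrank_ker
    rw [h1, finrank_top] at h2
    obtain ⟨x, hx⟩ := exists_ne (0 : X)
    obtain ⟨φ, hφ⟩ := hι X hX x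
    obtain ⟨p, rfl⟩ := hπ ι
    have h3 : φ.comp π ∈ LinearMap.ker (precomp K X d) := LinearMap.ext fun k => by
      have h4 : π (d k) = 0 := hdr.le ⟨k, rfl⟩
      exact (congrArg φ h4).trans (map_zero φ)
    have : Nontrivial (LinearMap.ker (precomp K X d)) :=
      ⟨⟨_, h3⟩, 0, fun h => hx (hφ ▸ LinearMap.congr_fun (congrArg Subtype.val h) p)⟩
    have h5 : 0 < Module.finrank K (LinearMap.ker (precomp K X d)) := Module.finrank_pos
    change Module.finrank K (P₁ →ₗ[A] X) < Module.finrank K ((Fin r → A) →ₗ[A] X)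
    omega
  · have := finite_hom A K P₁ (X := X)
    refine LinearMap.finrank_le_finrank_of_injective (f := precomp K X d) ?_
    rw [← LinearMap.ker_eq_bot, LinearMap.ker_eq_bot']
    intro g hg
    obtain ⟨v, hv⟩ := exists_comp_eq_of_ker_le hπ g (by
      rw [← hdr]
      rintro _ ⟨k, rfl⟩
      exact LinearMap.congr_fun hg k)
    rw [← hv, hX M hM v, LinearMap.zero_comp]

lemma apply_last_eq_add_sum {m : ℕ} (c : Fin (m + 1) → ℕ) (f : Fin m → ℕ)
    (h : ∀ j, c j.succ = c j.castSucc + f j) : c (Fin.last m) = c 0 + ∑ j, f j := by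
  induction m with
  | zero => simp
  | succ m ih =>
    rw [Fin.sum_univ_castSucc, ← Fin.succ_last, h, ← add_assoc]
    congr 1
    exact ih (fun j => c j.castSucc) (fun j => f j.castSucc) fun j => h j.castSucc

/-- The dimension of `Hom(P, X)` for a projective module `P` depends linearly on the
dimension vector of `X`. -/
lemma homDim_eq_sum {n : ℕ} (S : Fin n → ModuleCat.{0} A)
    (hdistinct : ∀ i j, Nonempty ((S i : Type) ≃ₗ[A] (S j : Type)) → i = j)
    (hcomplete : ∀ M : ModuleCat.{0} A, IsSimpleModule A M → ∃ i, Nonempty (M ≃ₗ[A] S i))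
    (P : Type) [AddCommGroup P] [Module A P] [Module.Finite A P] [Module.Projective A P]
    (X : Type) [AddCommGroup X] [Module A X] [Module.Finite A X] :
    homDim A K P X = ∑ i, dimVec A S X i * homDim A K P (S i) := by
  classical
  have : IsNoetherianRing A := IsNoetherianRing.of_finite K A
  have : IsArtinianRing A := IsArtinianRing.of_finite K A
  have h : ∃ s : CompositionSeries (Submodule A X),
      RelSeries.head s = ⊥ ∧ RelSeries.last s = ⊤ :=
    exists_compositionSeries_of_isNoetherian_isArtinian A X
  simp only [dimVec, dif_pos h]
  generalize hs : h.choose = s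
  obtain ⟨h0, h1⟩ := hs ▸ h.choose_spec
  set Q : Fin s.length → ModuleCat.{0} A := fun j =>
    ModuleCat.of A (↥(s j.succ) ⧸ Submodule.comap (s j.succ).subtype (s j.castSucc)) with hQ
  have hstep : ∀ j : Fin s.length, s j.castSucc ⋖ s j.succ := fun j => s.step j
  have hQs : ∀ j, IsSimpleModule A (Q j) := fun j =>
    (covBy_iff_quot_is_simple (hstep j).le).1 (hstep j)
  choose σ hσ using fun j => hcomplete (Q j) (hQs j)
  have hσ' : ∀ i j, Nonempty (Q j ≃ₗ[A] S i) ↔ σ j = i := fun i j => by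
    constructor
    · rintro ⟨e⟩
      obtain ⟨e'⟩ := hσ j
      exact hdistinct _ _ ⟨e'.symm.trans e⟩
    · rintro rfl
      exact hσ j
  have hcard : ∀ i, Nat.card {j : Fin s.length // Nonempty (Q j ≃ₗ[A] S i)} =
      (Finset.univ.filter fun j => σ j = i).card := fun i => by
    simp only [hσ', Nat.card_eq_fintype_card, Fintype.card_subtype]
  have htel := apply_last_eq_add_sum (fun j => homDim A K P (s j))
    (fun j => homDim A K P (S (σ j))) fun j => by
      obtain ⟨e⟩ := hσ j
      rw [← homDim_congr K P e]
      refine homDim_eq_add K P (Submodule.inclusion (hstep j).le) (Submodule.mkQ _)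
        (Submodule.inclusion_injective _) (Submodule.mkQ_surjective _) ?_
      rw [Submodule.range_inclusion, Submodule.ker_mkQ]
  have htop : homDim A K P (s (Fin.last s.length)) = homDim A K P X := by
    have h1' : s (Fin.last s.length) = ⊤ := h1
    rw [h1']
    exact homDim_congr K P Submodule.topEquiv
  have hbot : homDim A K P (s 0) = 0 := by
    have h0' : s 0 = ⊥ := h0
    rw [h0']
    have : Subsingleton (P →ₗ[A] (⊥ : Submodule A X)) :=
      ⟨fun f g => LinearMap.ext fun x => Subsingleton.elim _ _⟩
    exact Module.finrank_zero_of_subsingleton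
  rw [← htop]
  refine htel.trans ?_
  rw [hbot, zero_add, ← Finset.sum_fiberwise Finset.univ σ]
  refine Finset.sum_congr rfl fun i _ => ?_
  refine (Finset.sum_congr rfl fun j hj => by rw [(Finset.mem_filter.1 hj).2]).trans ?_
  rw [Finset.sum_const, smul_eq_mul]
  exact congrArg (· * homDim A K P (S i)) (hcard i).symm

include K in
/-- If the Newton polytope of `V` is contained in the one of `U`, then `V` lies in the torsion
class generated by `U`, provided that class is functorially finite. -/
lemma mem_torsGen_of_newtonPolytope_subset {n : ℕ} (S : Fin n → ModuleCat.{0} A)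
    (hsimple : ∀ i, IsSimpleModule A (S i))
    (hdistinct : ∀ i j, Nonempty ((S i : Type) ≃ₗ[A] (S j : Type)) → i = j)
    (hcomplete : ∀ M : ModuleCat.{0} A, IsSimpleModule A M → ∃ i, Nonempty (M ≃ₗ[A] S i))
    (U V : ModuleCat.{0} A) [Module.Finite A U] [Module.Finite A V] (hU : LeftFinite A U)
    (hsub : newtonPolytope A S V ⊆ newtonPolytope A S U) : V ∈ torsGen A U := by
  have : IsNoetherianRing A := IsNoetherianRing.of_finite K A
  obtain ⟨N, hNf, hN⟩ := hU
  have hT := isTorsionClass_torsGen U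
  obtain ⟨P₀, P₁, _, _, _, _, hpos, hneg⟩ := exists_projective_homDim K hT N hN
  obtain ⟨k, -, hkT, hk⟩ := hT.exists_radical ⟨U, self_mem_torsGen U⟩ (⊤ : Submodule A V)
  have hk0 : ∀ E : ModuleCat.{0} A, E ∈ torsGen A U → ∀ f : E →ₗ[A] V ⧸ k, f = 0 :=
    fun E hE f => hk E hE f (by
      rw [Submodule.map_top, Submodule.range_mkQ]
      exact le_top)
  by_cases hkt : k = ⊤
  · subst hkt
    exact hT.mem_of_surjective hkT Submodule.topEquiv.toLinearMap Submodule.topEquiv.surjective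
  exfalso
  have hkn : Nontrivial (V ⧸ k) := Submodule.Quotient.nontrivial_iff.2 hkt
  have hformula := fun (X : Type) [AddCommGroup X] [Module A X] [Module.Finite A X] =>
    homDim_eq_sum K S hdistinct hcomplete A X
  set Θ : (Fin n → ℝ) →ₗ[ℝ] ℝ := ∑ i, ((homDim A K P₀ (S i) : ℝ) - homDim A K P₁ (S i)) •
    LinearMap.proj i with hΘ
  have hΘ' : ∀ (X : Type) [AddCommGroup X] [Module A X] [Module.Finite A X],
      Θ (fun i => (dimVec A S X i : ℝ)) = (homDim A K P₀ X : ℝ) - homDim A K P₁ X := by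
    intro X _ _ _
    rw [homDim_eq_sum K S hdistinct hcomplete P₀ X, homDim_eq_sum K S hdistinct hcomplete P₁ X]
    push_cast
    rw [← Finset.sum_sub_distrib, hΘ, LinearMap.sum_apply]
    refine Finset.sum_congr rfl fun i _ => ?_
    simp only [LinearMap.smul_apply, LinearMap.proj_apply, smul_eq_mul]
    ring
  have hApos : ∀ (X : Type) [AddCommGroup X] [Module A X] [Module.Finite A X] [Nontrivial X],
      0 < homDim A K A X := by
    intro X _ _ _ _
    obtain ⟨x, hx⟩ := exists_ne (0 : X)
    refine homDim_pos K (f := LinearMap.toSpanSingleton A X x) fun h => hx ?_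
    simpa using LinearMap.congr_fun h 1
  have hconv : Convex ℝ ({v | 0 < Θ v} ∪ {0} : Set (Fin n → ℝ)) := by
    rintro v hv w hw a b ha hb hab
    rcases hv with hv | rfl <;> rcases hw with hw | rfl
    · left
      have hv' : 0 < Θ v := hv
      have hw' : 0 < Θ w := hw
      change 0 < Θ (a • v + b • w)
      rw [map_add, map_smul, map_smul, smul_eq_mul, smul_eq_mul]
      rcases ha.eq_or_lt with rfl | ha
      · have : b = 1 := by linarith
        subst this
        linarith
      · have := mul_pos ha hv'
        have := mul_nonneg hb hw'.le
        linarith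
    · have hv' : 0 < Θ v := hv
      rw [smul_zero, add_zero]
      rcases ha.eq_or_lt with rfl | ha
      · right
        simp
      · left
        change 0 < Θ (a • v)
        rw [map_smul]
        exact mul_pos ha hv'
    · have hw' : 0 < Θ w := hw
      rw [smul_zero, zero_add]
      rcases hb.eq_or_lt with rfl | hb
      · right
        simp
      · left
        change 0 < Θ (b • w)
        rw [map_smul]
        exact mul_pos hb hw'
    · right
      simp
  have hsubset : newtonPolytope A S U ⊆ {v | 0 < Θ v} ∪ {0} := by
    refine convexHull_min ?_ hconv
    rintro _ ⟨p, rfl⟩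
    rcases subsingleton_or_nontrivial (U ⧸ p) with hs | hn
    · right
      have h1 : homDim A K A (U ⧸ p) = 0 := by
        have : Subsingleton (A →ₗ[A] U ⧸ p) :=
          ⟨fun f g => LinearMap.ext fun x => Subsingleton.elim _ _⟩
        exact Module.finrank_zero_of_subsingleton
      rw [hformula] at h1
      refine funext fun i => ?_
      have h2 := Finset.sum_eq_zero_iff.1 h1 i (Finset.mem_univ i)
      have := hsimple i
      have : Nontrivial (S i) := IsSimpleModule.nontrivial A (S i)
      have h3 := (mul_eq_zero.1 h2).resolve_right (hApos (S i)).ne'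
      simpa using h3
    · left
      change 0 < Θ _
      rw [hΘ']
      have h1 := hpos (ModuleCat.of A (U ⧸ p))
        (hT.mem_of_surjective (self_mem_torsGen U) p.mkQ p.mkQ_surjective) hn
      exact sub_pos.2 (Nat.cast_lt.2 h1)
  have hmem := hsubset (hsub (subset_convexHull ℝ _ ⟨k, rfl⟩))
  rcases hmem with h1 | h1
  · have h2 : 0 < Θ _ := h1
    rw [hΘ'] at h2
    have h3 := hneg (ModuleCat.of A (V ⧸ k)) (inferInstanceAs (Module.Finite A (V ⧸ k))) hk0
    exact absurd (Nat.cast_lt.1 (sub_pos.1 h2)) (not_lt.2 h3)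
  · have h2 := hApos (V ⧸ k)
    rw [hformula] at h2
    refine h2.ne' (Finset.sum_eq_zero fun i _ => ?_)
    have h3 : (dimVec A S (V ⧸ k) i : ℝ) = 0 := congrFun h1 i
    rw [Nat.cast_eq_zero.1 h3, zero_mul]

end Algebra

end TorsionClasses

/-- if `A` is τ-tilting finite (i.e. `mod A` has only finitely many torsion
classes), then bricks with the same Newton polytope are isomorphic. -/
theorem iso_of_brick_of_newtonPolytope_eq_of_tauTiltingFinite (A : Type) [Ring A]
    (K : Type) [Field K] [Algebra K A] [FiniteDimensional K A]
    (n : ℕ) (S : Fin n → ModuleCat.{0} A)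
    (hsimple : ∀ i, IsSimpleModule A (S i))
    (hdistinct : ∀ i j, Nonempty ((S i : Type) ≃ₗ[A] (S j : Type)) → i = j)
    (hcomplete : ∀ M : ModuleCat.{0} A, IsSimpleModule A M → ∃ i, Nonempty (M ≃ₗ[A] S i))
    (hfin : {T : Set (ModuleCat.{0} A) | IsTorsionClass A T}.Finite)
    (U V : ModuleCat.{0} A) (hU : Module.Finite A U) (hV : Module.Finite A V)
    (hUb : IsBrick A U) (hVb : IsBrick A V)
    (hNewton : newtonPolytope A S U = newtonPolytope A S V) :
    Nonempty (U ≃ₗ[A] V) := by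
  have hlf : ∀ W : ModuleCat.{0} A, Module.Finite A W → LeftFinite A W := fun W hW =>
    exists_eq_fac K hfin (isTorsionClass_torsGen W) ⟨W, self_mem_torsGen W⟩
  exact nonempty_equiv_of_mem_torsGen hUb hVb
    (mem_torsGen_of_newtonPolytope_subset K S hsimple hdistinct hcomplete V U (hlf V hV)
      hNewton.le)
    (mem_torsGen_of_newtonPolytope_subset K S hsimple hdistinct hcomplete U V (hlf U hU)
      hNewton.ge)
end

section
/- Let M be a τ-rigid module in mod A. Then Fac M is a torsion class in mod A; in particular, Fac M is closed under extensions: for any short exact sequence 0 → L → E → N → 0 in mod A with L and N in Fac M, the module E lies in Fac M. -/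
/-! Common definitions: finite-dimensional modules over a finite-dimensional algebra,
quotient modules, dimension vectors via composition series, Newton polytopes,
torsion classes, `Fac`, τ-rigidity, bricks, etc. -/

variable (A : Type) [Ring A]

variable {A} in
/-- A quotient of a product of two finite powers of `M` lies in `Fac M`. -/
theorem mem_Fac_of_surjective_prod {M X : ModuleCat.{0} A} {k l : ℕ}
    (f : ((Fin k → M) × (Fin l → M)) →ₗ[A] X) (hf : Function.Surjective f) : X ∈ Fac A M := by
  let e : (Fin (k + l) → M) ≃ₗ[A] (Fin k → M) × (Fin l → M) :=
    (LinearEquiv.funCongrLeft A M finSumFinEquiv).trans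
      (LinearEquiv.sumArrowLequivProdArrow (Fin k) (Fin l) A M)
  exact ⟨k + l, f ∘ₗ e.toLinearMap, hf.comp e.surjective⟩

variable {A} in
/-- A homomorphism out of a τ-rigid module `M` lifts along a surjection with kernel in `Fac M`:
the pullback extension splits. -/
theorem IsTauRigid.exists_lift {M L E N : ModuleCat.{0} A} (hM : IsTauRigid A M)
    (f : L →ₗ[A] E) (g : E →ₗ[A] N) (hf : Function.Injective f) (hg : Function.Surjective g)
    (hfg : LinearMap.range f = LinearMap.ker g) (hL : L ∈ Fac A M) (h : M →ₗ[A] N) :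
    ∃ s : M →ₗ[A] E, g ∘ₗ s = h := by
  have hgf (x : L) : g (f x) = 0 := LinearMap.mem_ker.1 (hfg ▸ LinearMap.mem_range_self f x)
  let P : Submodule A (E × M) :=
    LinearMap.eqLocus (g ∘ₗ LinearMap.fst A E M) (h ∘ₗ LinearMap.snd A E M)
  have hP (x : P) : g x.1.1 = h x.1.2 := x.2
  let i : L →ₗ[A] P := (LinearMap.inl A E M ∘ₗ f).codRestrict P fun x => by
    simp [P, hgf]
  let q : P →ₗ[A] M := LinearMap.snd A E M ∘ₗ P.subtype
  obtain ⟨s, hs⟩ := hM L hL (ModuleCat.of A P) i q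
    (fun x y hxy => hf (congrArg (fun z : P => z.1.1) hxy))
    (fun m => by
      obtain ⟨e, he⟩ := hg (h m)
      exact ⟨⟨(e, m), he⟩, rfl⟩)
    (by
      ext x
      constructor
      · rintro ⟨y, rfl⟩
        rfl
      · intro hx
        have hx2 : x.1.2 = 0 := hx
        have hx1 : x.1.1 ∈ LinearMap.range f := by
          rw [hfg, LinearMap.mem_ker, hP, hx2, map_zero]
        obtain ⟨y, hy⟩ := hx1
        exact ⟨y, Subtype.ext (Prod.ext hy hx2.symm)⟩)
  refine ⟨LinearMap.fst A E M ∘ₗ P.subtype ∘ₗ s, LinearMap.ext fun m => ?_⟩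
  exact (hP (s m)).trans (congrArg h (LinearMap.congr_fun hs m))

variable {A} in
/-- A homomorphism out of a finite power of a τ-rigid module `M` lifts along a surjection
with kernel in `Fac M`. -/
theorem IsTauRigid.exists_lift_pi {M L E N : ModuleCat.{0} A} (hM : IsTauRigid A M)
    (f : L →ₗ[A] E) (g : E →ₗ[A] N) (hf : Function.Injective f) (hg : Function.Surjective g)
    (hfg : LinearMap.range f = LinearMap.ker g) (hL : L ∈ Fac A M) {k : ℕ}
    (h : (Fin k → M) →ₗ[A] N) : ∃ s : (Fin k → M) →ₗ[A] E, g ∘ₗ s = h := by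
  choose s hs using fun j =>
    hM.exists_lift f g hf hg hfg hL (h ∘ₗ LinearMap.single A (fun _ : Fin k => M) j)
  refine ⟨LinearMap.lsum A (fun _ => M) ℕ s, LinearMap.pi_ext' fun j => ?_⟩
  rw [LinearMap.comp_assoc, ← hs j]
  exact congrArg (g ∘ₗ ·) (LinearMap.ext fun m => LinearMap.lsum_piSingle A (fun _ => M) ℕ s j m)

/-- if `M` is a τ-rigid module in `mod A`, then `Fac M` is a torsion class;
in particular it is closed under extensions. -/
theorem Fac_isTorsionClass_of_tauRigid (A : Type) [Ring A]
    (K : Type) [Field K] [Algebra K A] [FiniteDimensional K A]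
    (M : ModuleCat.{0} A) (hM : Module.Finite A M) (hMr : IsTauRigid A M) :
    IsTorsionClass A (Fac A M) := by
  refine ⟨?_, ?_, ?_, ?_⟩
  · rintro X ⟨k, f, hf⟩
    exact Module.Finite.of_surjective f hf
  · rintro X ⟨k, f, hf⟩ Y ⟨e⟩
    exact ⟨k, e.toLinearMap ∘ₗ f, e.surjective.comp hf⟩
  · rintro X ⟨k, f, hf⟩ Y ⟨q, hq⟩
    exact ⟨k, q ∘ₗ f, hq.comp hf⟩
  · rintro L E N f g hf hg hfg hL ⟨k, p, hp⟩
    obtain ⟨s, hs⟩ := hMr.exists_lift_pi f g hf hg hfg hL p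
    obtain ⟨l, r, hr⟩ := hL
    refine mem_Fac_of_surjective_prod ((f ∘ₗ r).coprod s) fun e => ?_
    obtain ⟨y, hy⟩ := hp (g e)
    have he : e - s y ∈ LinearMap.range f := by
      rw [hfg, LinearMap.mem_ker, map_sub, ← hy, ← hs, LinearMap.comp_apply, sub_self]
    obtain ⟨x, hx⟩ := he
    obtain ⟨z, rfl⟩ := hr x
    exact ⟨(z, y), by simp [hx]⟩
end
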